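/- Let M=(Q,Σ,μ,F) be a dwta over the commutative semifield S whose states are all live, let sol assign to every ∼_M-class B a context sol(B)∈C_Σ(Q) that is a sign of life for every state in B with sol(B)=□ whenever B⊆F, and let λ(q) = h_μ^{(2)}(sol([q]_{∼_M})[q]) for every q∈Q. Then the Myhill–Nerode equivalence ≡_M of M is a congruence of the alphabetic dwta syn(push_λ(M)) that respects F. -/

import Mathlib

open scoped BigOperators Classical

namespace WTA

/-- Trees over a ranked alphabet `Sig` (with arity map `ar`), indexed by states `Q`. -/
inductive PTree (Sig : Type) (ar : Sig → ℕ) (Q : Type) : Type where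
  | state : Q → PTree Sig ar Q
  | node : (s : Sig) → (Fin (ar s) → PTree Sig ar Q) → PTree Sig ar Q

/-- Contexts: trees with exactly one occurrence of the hole `□` at a leaf. -/
inductive Ctx (Sig : Type) (ar : Sig → ℕ) (Q : Type) : Type where
  | hole : Ctx Sig ar Q
  | node : (s : Sig) → (i : Fin (ar s)) → (Fin (ar s) → PTree Sig ar Q) →
      Ctx Sig ar Q → Ctx Sig ar Q

variable {Sig Q Q' S : Type} {ar : Sig → ℕ}

/-- Substitution `c[t]` of a tree into the hole of a context. -/
def Ctx.subst : Ctx Sig ar Q → PTree Sig ar Q → PTree Sig ar Q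
  | .hole, t => t
  | .node s i ts c, t => .node s (Function.update ts i (c.subst t))

/-- A closed tree (over `T_Σ`) viewed as a tree indexed by `Q`. -/
def PTree.ofClosed : PTree Sig ar Empty → PTree Sig ar Q
  | .state e => e.elim
  | .node s ts => .node s fun i => (ts i).ofClosed

/-- A closed context viewed as a context with states in `Q`. -/
def Ctx.ofClosed : Ctx Sig ar Empty → Ctx Sig ar Q
  | .hole => .hole
  | .node s i ts c => .node s i (fun j => (ts j).ofClosed) c.ofClosed

/-- Renaming of the states occurring in a tree. -/
def PTree.rename (g : Q → Q') : PTree Sig ar Q → PTree Sig ar Q'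
  | .state p => .state (g p)
  | .node s ts => .node s fun i => (ts i).rename g

/-- Renaming of the states occurring in a context. -/
def Ctx.rename (g : Q → Q') : Ctx Sig ar Q → Ctx Sig ar Q'
  | .hole => .hole
  | .node s i ts c => .node s i (fun j => (ts j).rename g) (c.rename g)

/-- The extension `h_μ` of the transition weight assignment `μ` to trees:
`h_μ(t → q)`. -/
noncomputable def hmu [Fintype Q] [CommSemiring S]
    (μ : ∀ s : Sig, (Fin (ar s) → Q) → Q → S) : PTree Sig ar Q → Q → S
  | .state p, q => if p = q then 1 else 0
  | .node s ts, q => ∑ qs : Fin (ar s) → Q, μ s qs q * ∏ i, hmu μ (ts i) (qs i)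

/-- The weighted tree language recognized by the wta `(Q, Σ, μ, F)`:
`M(t) = Σ_{q ∈ F} h_μ(t → q)`. -/
noncomputable def wtaSem [Fintype Q] [CommSemiring S]
    (μ : ∀ s : Sig, (Fin (ar s) → Q) → Q → S) (F : Finset Q)
    (t : PTree Sig ar Empty) : S :=
  ∑ q ∈ F, hmu μ (PTree.ofClosed t) q

/-- Bottom-up determinism: every left-hand side `σ(q₁,…,q_k)` has at most one
target state with nonzero weight. -/
def Deterministic [CommSemiring S] (μ : ∀ s : Sig, (Fin (ar s) → Q) → Q → S) : Prop :=
  ∀ (s : Sig) (qs : Fin (ar s) → Q) (q q' : Q), μ s qs q ≠ 0 → μ s qs q' ≠ 0 → q = q'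

/-- The pushed transition weight assignment
`μ'(σ(q₁,…,q_k) → q) = λ(q) · μ(σ(q₁,…,q_k) → q) · ∏ᵢ λ(qᵢ)⁻¹`. -/
noncomputable def push [Fintype Q] [Semifield S] (lam : Q → S)
    (μ : ∀ s : Sig, (Fin (ar s) → Q) → Q → S) :
    ∀ s : Sig, (Fin (ar s) → Q) → Q → S :=
  fun s qs q => lam q * μ s qs q * ∏ i, (lam (qs i))⁻¹

/-- `h_μ^{(1)}(t) ∈ F` (for a deterministic wta): some final state is reached
with nonzero weight. -/
def finReach [Fintype Q] [CommSemiring S]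
    (μ : ∀ s : Sig, (Fin (ar s) → Q) → Q → S) (F : Finset Q)
    (t : PTree Sig ar Q) : Prop :=
  ∃ q ∈ F, hmu μ t q ≠ 0

/-- `h_μ^{(2)}(t) · χ_F(h_μ^{(1)}(t))` (for a deterministic wta); an undefined
value counts as `0`. -/
noncomputable def cweight [Fintype Q] [CommSemiring S]
    (μ : ∀ s : Sig, (Fin (ar s) → Q) → Q → S) (F : Finset Q)
    (t : PTree Sig ar Q) : S :=
  ∑ q ∈ F, hmu μ t q

/-- `h_μ^{(2)}(t)` (for a deterministic wta); an undefined value counts as `0`. -/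
noncomputable def tweight [Fintype Q] [CommSemiring S]
    (μ : ∀ s : Sig, (Fin (ar s) → Q) → Q → S) (t : PTree Sig ar Q) : S :=
  ∑ q, hmu μ t q

/-- A context `c` is a sign of life for the state `q` if `h_μ^{(1)}(c[q]) ∈ F`. -/
def SignOfLife [Fintype Q] [CommSemiring S]
    (μ : ∀ s : Sig, (Fin (ar s) → Q) → Q → S) (F : Finset Q)
    (c : Ctx Sig ar Q) (q : Q) : Prop :=
  finReach μ F (c.subst (.state q))

/-- A state is live if it has a sign of life. -/
def Live [Fintype Q] [CommSemiring S]
    (μ : ∀ s : Sig, (Fin (ar s) → Q) → Q → S) (F : Finset Q) (q : Q) : Prop :=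
  ∃ c : Ctx Sig ar Q, SignOfLife μ F c q

/-- Weak equivalence `q₁ ∼_M q₂`. -/
def WeakEquiv [Fintype Q] [CommSemiring S]
    (μ : ∀ s : Sig, (Fin (ar s) → Q) → Q → S) (F : Finset Q)
    (q₁ q₂ : Q) : Prop :=
  ∀ c : Ctx Sig ar Q,
    finReach μ F (c.subst (.state q₁)) ↔ finReach μ F (c.subst (.state q₂))

/-- Myhill–Nerode equivalence `q₁ ≡_M q₂`: there is a nonzero factor `s` with
`h_μ^{(2)}(c[q₁])·χ_F(h_μ^{(1)}(c[q₁])) = s · h_μ^{(2)}(c[q₂])·χ_F(h_μ^{(1)}(c[q₂]))`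
for all contexts `c`. -/
def MNEquiv [Fintype Q] [CommSemiring S]
    (μ : ∀ s : Sig, (Fin (ar s) → Q) → Q → S) (F : Finset Q)
    (q₁ q₂ : Q) : Prop :=
  ∃ s : S, s ≠ 0 ∧ ∀ c : Ctx Sig ar Q,
    cweight μ F (c.subst (.state q₁)) = s * cweight μ F (c.subst (.state q₂))

/-- `r` is a congruence of the dwta: equivalent left-hand sides have equivalent
targets (`μ^{(1)}`-values), where two undefined values are regarded as
equivalent and an undefined value is never equivalent to a defined one. -/
def IsCongruence [Fintype Q] [CommSemiring S]
    (μ : ∀ s : Sig, (Fin (ar s) → Q) → Q → S) (r : Q → Q → Prop) : Prop :=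
  ∀ (s : Sig) (qs qs' : Fin (ar s) → Q), (∀ i, r (qs i) (qs' i)) →
    ((∃ q, μ s qs q ≠ 0) ↔ (∃ q, μ s qs' q ≠ 0)) ∧
    (∀ q q', μ s qs q ≠ 0 → μ s qs' q' ≠ 0 → r q q')

/-- `r` respects `F`: every class lies inside `F` or outside `F`. -/
def Respects (r : Q → Q → Prop) (F : Finset Q) : Prop :=
  ∀ q q', r q q' → (q ∈ F ↔ q' ∈ F)

/-- Accessibility: every state is reached by some (closed) tree. -/
def Accessible [Fintype Q] [CommSemiring S]
    (μ : ∀ s : Sig, (Fin (ar s) → Q) → Q → S) : Prop :=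
  ∀ q : Q, ∃ t : PTree Sig ar Empty, hmu μ (PTree.ofClosed t) q ≠ 0

/-- The transition weight assignment of the alphabetic dwta `syn(N)` over the
ranked alphabet `Σ × S` (where `⟨σ, s⟩` has the rank of `σ`):
`ν''(⟨σ,s⟩(q₁,…,q_k) → q) = 1` iff `ν(σ(q₁,…,q_k) → q) = s ≠ 0`. -/
noncomputable def synMu [Fintype Q] [CommSemiring S]
    (ν : ∀ s : Sig, (Fin (ar s) → Q) → Q → S) :
    ∀ p : Sig × S, (Fin ((fun p : Sig × S => ar p.1) p) → Q) → Q → S :=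
  fun p qs q => if ν p.1 qs q = p.2 ∧ p.2 ≠ 0 then 1 else 0

/-- Runs of the unweighted tree automaton `unw(M)` with transitions `supp(μ)`:
`Reach μ t q` iff `unw(M)` can reach state `q` on the tree `t`. -/
inductive Reach [CommSemiring S] (μ : ∀ s : Sig, (Fin (ar s) → Q) → Q → S) :
    PTree Sig ar Q → Q → Prop where
  | state (q : Q) : Reach μ (.state q) q
  | node {s : Sig} (ts : Fin (ar s) → PTree Sig ar Q) (qs : Fin (ar s) → Q) (q : Q)
      (h : μ s qs q ≠ 0) (hc : ∀ i, Reach μ (ts i) (qs i)) : Reach μ (.node s ts) q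

/-- Composition of contexts: `(c.comp d)[t] = c[d[t]]`. -/
def Ctx.comp : Ctx Sig ar Q → Ctx Sig ar Q → Ctx Sig ar Q
  | .hole, d => d
  | .node s i ts c, d => .node s i ts (c.comp d)

theorem Ctx.subst_comp (c d : Ctx Sig ar Q) (t : PTree Sig ar Q) :
    (c.comp d).subst t = c.subst (d.subst t) := by
  induction c with
  | hole => rfl
  | node s i ts c ih => simp only [Ctx.comp, Ctx.subst, ih]

/-- In a deterministic wta every tree has at most one target state of nonzero weight. -/
theorem Deterministic.hmu_unique [Fintype Q] [CommSemiring S]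
    {μ : ∀ s : Sig, (Fin (ar s) → Q) → Q → S} (hdet : Deterministic μ)
    (t : PTree Sig ar Q) : ∀ q q' : Q, hmu μ t q ≠ 0 → hmu μ t q' ≠ 0 → q = q' := by
  induction t with
  | state p =>
    intro q q' h h'
    simp only [hmu, ne_eq, ite_eq_right_iff, not_forall] at h h'
    exact h.1.symm.trans h'.1
  | node s ts ih =>
    intro q q' h h'
    simp only [hmu] at h h'
    obtain ⟨qs, -, hqs⟩ := Finset.exists_ne_zero_of_sum_ne_zero h
    obtain ⟨qs', -, hqs'⟩ := Finset.exists_ne_zero_of_sum_ne_zero h'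
    have factor_ne_zero : ∀ (ps : Fin (ar s) → Q) (i : Fin (ar s)),
        ∏ j, hmu μ (ts j) (ps j) ≠ 0 → hmu μ (ts i) (ps i) ≠ 0 := fun ps i hp hi =>
      hp (Finset.prod_eq_zero (Finset.mem_univ i) hi)
    obtain rfl : qs = qs' := funext fun i => ih i _ _
      (factor_ne_zero qs i (right_ne_zero_of_mul hqs))
      (factor_ne_zero qs' i (right_ne_zero_of_mul hqs'))
    exact hdet s qs q q' (left_ne_zero_of_mul hqs) (left_ne_zero_of_mul hqs')

/-- In a deterministic wta, a sum of tree weights containing a nonzero term equals that term. -/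
theorem Deterministic.sum_hmu_eq [Fintype Q] [CommSemiring S]
    {μ : ∀ s : Sig, (Fin (ar s) → Q) → Q → S} (hdet : Deterministic μ)
    {t : PTree Sig ar Q} {A : Finset Q} {q : Q} (hq : q ∈ A) (h : hmu μ t q ≠ 0) :
    ∑ p ∈ A, hmu μ t p = hmu μ t q := by
  refine Finset.sum_eq_single_of_mem q hq fun p _ hpq => ?_
  by_contra hp
  exact hpq (hdet.hmu_unique t p q hp h)

theorem Deterministic.finReach_iff [Fintype Q] [CommSemiring S]
    {μ : ∀ s : Sig, (Fin (ar s) → Q) → Q → S} (hdet : Deterministic μ)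
    {F : Finset Q} {t : PTree Sig ar Q} : finReach μ F t ↔ cweight μ F t ≠ 0 := by
  constructor
  · rintro ⟨q, hq, h⟩
    rwa [cweight, hdet.sum_hmu_eq hq h]
  · exact Finset.exists_ne_zero_of_sum_ne_zero

theorem Deterministic.tweight_eq_cweight [Fintype Q] [CommSemiring S]
    {μ : ∀ s : Sig, (Fin (ar s) → Q) → Q → S} (hdet : Deterministic μ)
    {F : Finset Q} {t : PTree Sig ar Q} (h : finReach μ F t) :
    tweight μ t = cweight μ F t := by
  obtain ⟨q, hq, h⟩ := h
  rw [tweight, cweight, hdet.sum_hmu_eq hq h, hdet.sum_hmu_eq (Finset.mem_univ q) h]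

/-- The weight of `c[t]` is linear in the weights of `t`. -/
theorem hmu_subst [Fintype Q] [CommSemiring S]
    (μ : ∀ s : Sig, (Fin (ar s) → Q) → Q → S) (c : Ctx Sig ar Q) (t : PTree Sig ar Q) :
    ∀ r : Q, hmu μ (c.subst t) r = ∑ q, hmu μ t q * hmu μ (c.subst (.state q)) r := by
  induction c with
  | hole => intro r; simp [Ctx.subst, hmu]
  | node s i ts c ih =>
    intro r
    have prod_update : ∀ (u : PTree Sig ar Q) (qs : Fin (ar s) → Q),
        ∏ j, hmu μ (Function.update ts i u j) (qs j) =
          hmu μ u (qs i) * ∏ j ∈ Finset.univ.erase i, hmu μ (ts j) (qs j) := by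
      intro u qs
      rw [← Finset.mul_prod_erase _ _ (Finset.mem_univ i), Function.update_self]
      congr 1
      refine Finset.prod_congr rfl fun j hj => ?_
      rw [Function.update_of_ne (Finset.ne_of_mem_erase hj)]
    simp only [Ctx.subst, hmu, prod_update, ih, Finset.mul_sum, Finset.sum_mul]
    rw [Finset.sum_comm]
    refine Finset.sum_congr rfl fun q _ => Finset.sum_congr rfl fun qs _ => ?_
    ring

theorem hmu_node_state [Fintype Q] [CommSemiring S]
    (μ : ∀ s : Sig, (Fin (ar s) → Q) → Q → S) (s : Sig) (qs : Fin (ar s) → Q) (q : Q) :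
    hmu μ (.node s fun i => .state (qs i)) q = μ s qs q := by
  simp only [hmu]
  rw [Finset.sum_eq_single qs]
  · simp
  · intro ps _ hps
    obtain ⟨i, hi⟩ := Function.ne_iff.mp hps
    rw [Finset.prod_eq_zero (Finset.mem_univ i) (if_neg (Ne.symm hi)), mul_zero]
  · simp

theorem cweight_subst_node [Fintype Q] [CommSemiring S]
    (μ : ∀ s : Sig, (Fin (ar s) → Q) → Q → S) (F : Finset Q) (c : Ctx Sig ar Q)
    (s : Sig) (qs : Fin (ar s) → Q) :
    cweight μ F (c.subst (.node s fun i => .state (qs i))) =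
      ∑ q, μ s qs q * cweight μ F (c.subst (.state q)) := by
  simp only [cweight, hmu_subst μ c (.node s _), hmu_node_state, Finset.mul_sum]
  exact Finset.sum_comm

theorem Deterministic.cweight_subst_node [Fintype Q] [CommSemiring S]
    {μ : ∀ s : Sig, (Fin (ar s) → Q) → Q → S} (hdet : Deterministic μ) (F : Finset Q)
    (c : Ctx Sig ar Q) {s : Sig} {qs : Fin (ar s) → Q} {q : Q} (h : μ s qs q ≠ 0) :
    cweight μ F (c.subst (.node s fun i => .state (qs i))) =
      μ s qs q * cweight μ F (c.subst (.state q)) := by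
  rw [WTA.cweight_subst_node]
  refine Finset.sum_eq_single_of_mem q (Finset.mem_univ q) fun p _ hpq => ?_
  rw [of_not_not fun hp => hpq (hdet s qs p q hp h), zero_mul]

/-- Factors relating the arguments of a symbol multiply to a factor relating the whole trees. -/
theorem cweight_subst_node_eq_prod_mul [Fintype Q] [CommSemiring S]
    (μ : ∀ s : Sig, (Fin (ar s) → Q) → Q → S) (F : Finset Q) {s : Sig}
    {qs qs' : Fin (ar s) → Q} {w : Fin (ar s) → S}
    (hw : ∀ i (c : Ctx Sig ar Q), cweight μ F (c.subst (.state (qs i))) =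
      w i * cweight μ F (c.subst (.state (qs' i)))) (c : Ctx Sig ar Q) :
    cweight μ F (c.subst (.node s fun i => .state (qs i))) =
      (∏ i, w i) * cweight μ F (c.subst (.node s fun i => .state (qs' i))) := by
  have partial_exchange : ∀ I : Finset (Fin (ar s)),
      cweight μ F (c.subst (.node s fun i => .state (qs i))) =
        (∏ i ∈ I, w i) *
          cweight μ F (c.subst (.node s fun i => .state (if i ∈ I then qs' i else qs i))) := by
    intro I
    induction I using Finset.induction_on with
    | empty => simp
    | insert a I ha ih =>
      let ps : Fin (ar s) → PTree Sig ar Q := fun i => .state (if i ∈ I then qs' i else qs i)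
      have plug : ∀ q : Q, (c.comp (.node s a ps .hole)).subst (.state q) =
          c.subst (.node s (Function.update ps a (.state q))) := fun q => by
        rw [Ctx.subst_comp]; rfl
      have before : Function.update ps a (.state (qs a)) = ps := by
        simp [ps, ha]
      have after : Function.update ps a (.state (qs' a)) =
          fun i => .state (if i ∈ insert a I then qs' i else qs i) := by
        funext i
        rcases eq_or_ne i a with rfl | hi
        · simp
        · simp [ps, hi]
      have step := hw a (c.comp (.node s a ps .hole))
      rw [plug, plug, before, after] at step
      rw [ih, step, Finset.prod_insert ha]
      ring
  simpa using partial_exchange Finset.univ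

theorem mnEquiv_equivalence [Fintype Q] [Semifield S]
    (μ : ∀ s : Sig, (Fin (ar s) → Q) → Q → S) (F : Finset Q) :
    Equivalence (MNEquiv μ F) where
  refl q := ⟨1, one_ne_zero, fun c => (one_mul _).symm⟩
  symm := by
    rintro q q' ⟨w, hw, h⟩
    exact ⟨w⁻¹, inv_ne_zero hw, fun c => by rw [h c, inv_mul_cancel_left₀ hw]⟩
  trans := by
    rintro q q' q'' ⟨w, hw, h⟩ ⟨w', hw', h'⟩
    exact ⟨w * w', mul_ne_zero hw hw', fun c => by rw [h c, h' c, mul_assoc]⟩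

theorem MNEquiv.weakEquiv [Fintype Q] [Semifield S]
    {μ : ∀ s : Sig, (Fin (ar s) → Q) → Q → S} {F : Finset Q} (hdet : Deterministic μ)
    {q q' : Q} (h : MNEquiv μ F q q') : WeakEquiv μ F q q' := by
  obtain ⟨w, hw, h⟩ := h
  intro c
  rw [hdet.finReach_iff, hdet.finReach_iff, h c, mul_ne_zero_iff_left hw]

theorem mnEquiv_respects [Fintype Q] [Semifield S]
    {μ : ∀ s : Sig, (Fin (ar s) → Q) → Q → S} {F : Finset Q} (hdet : Deterministic μ) :
    Respects (MNEquiv μ F) F := by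
  intro q q' h
  simpa [finReach, Ctx.subst, hmu] using h.weakEquiv hdet .hole

theorem synMu_ne_zero_iff [Fintype Q] [CommSemiring S] [Nontrivial S]
    (ν : ∀ s : Sig, (Fin (ar s) → Q) → Q → S) (p : Sig × S)
    (qs : Fin (ar p.1) → Q) (q : Q) :
    synMu ν p qs q ≠ 0 ↔ ν p.1 qs q = p.2 ∧ p.2 ≠ 0 := by
  simp [synMu]

/-- Equivalent left-hand sides have equivalent targets of the same pushed weight. -/
theorem exists_mnEquiv_push_eq [Fintype Q] [Semifield S]
    {μ : ∀ s : Sig, (Fin (ar s) → Q) → Q → S} {F : Finset Q} (hdet : Deterministic μ)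
    {sol : Q → Ctx Sig ar Q} (hsol : ∀ q : Q, SignOfLife μ F (sol q) q)
    (hsolcl : ∀ q q' : Q, WeakEquiv μ F q q' → sol q = sol q')
    {lam : Q → S} (hlam : ∀ q : Q, lam q = tweight μ ((sol q).subst (.state q)))
    {s : Sig} {qs qs' : Fin (ar s) → Q} (hqs : ∀ i, MNEquiv μ F (qs i) (qs' i))
    {q : Q} (hq : μ s qs q ≠ 0) :
    ∃ q', μ s qs' q' ≠ 0 ∧ MNEquiv μ F q q' ∧ push lam μ s qs' q' = push lam μ s qs q := by
  have lam_eq : ∀ p, lam p = cweight μ F ((sol p).subst (.state p)) := fun p =>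
    (hlam p).trans (hdet.tweight_eq_cweight (hsol p))
  choose w hw hwc using hqs
  have hprod : ∏ i, w i ≠ 0 := Finset.prod_ne_zero_iff.mpr fun i _ => hw i
  have key := cweight_subst_node_eq_prod_mul μ F hwc
  obtain ⟨q', hq'⟩ : ∃ q', μ s qs' q' ≠ 0 := by
    by_contra! hzero
    have h := key (sol q)
    rw [hdet.cweight_subst_node F _ hq, cweight_subst_node] at h
    simp only [hzero, zero_mul, Finset.sum_const_zero, mul_zero] at h
    exact mul_ne_zero hq (hdet.finReach_iff.mp (hsol q)) h
  have target : ∀ c : Ctx Sig ar Q, μ s qs q * cweight μ F (c.subst (.state q)) =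
      (∏ i, w i) * (μ s qs' q' * cweight μ F (c.subst (.state q'))) := fun c => by
    rw [← hdet.cweight_subst_node F c hq, ← hdet.cweight_subst_node F c hq', key c]
  have hequiv : MNEquiv μ F q q' := by
    refine ⟨(μ s qs q)⁻¹ * ((∏ i, w i) * μ s qs' q'),
      mul_ne_zero (inv_ne_zero hq) (mul_ne_zero hprod hq'), fun c => ?_⟩
    rw [mul_assoc, mul_assoc, ← target c, inv_mul_cancel_left₀ hq]
  refine ⟨q', hq', hequiv, ?_⟩
  have lam_args : ∀ i, lam (qs i) = w i * lam (qs' i) := fun i => by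
    have hi : MNEquiv μ F (qs i) (qs' i) := ⟨w i, hw i, hwc i⟩
    rw [lam_eq, lam_eq, hwc, hsolcl _ _ (hi.weakEquiv hdet)]
  have lam_target : lam q * μ s qs q = (∏ i, w i) * (lam q' * μ s qs' q') := by
    rw [lam_eq q, lam_eq q', ← hsolcl _ _ (hequiv.weakEquiv hdet), mul_comm, target,
      mul_comm (μ s qs' q')]
  simp only [push, lam_target, lam_args, mul_inv, Finset.prod_mul_distrib,
    Finset.prod_inv_distrib]
  rw [mul_mul_mul_comm, mul_inv_cancel₀ hprod, one_mul]

/-- With pushing weights `λ(q) = h_μ^{(2)}(sol([q]_{∼_M})[q])`,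
the Myhill–Nerode equivalence `≡_M` of `M` is a congruence of the alphabetic
dwta `syn(push_λ(M))` that respects `F`. -/
theorem mnEquiv_isCongruence_syn {Sig Q S : Type} {ar : Sig → ℕ}
    [Fintype Q] [Semifield S]
    (μ : ∀ s : Sig, (Fin (ar s) → Q) → Q → S) (F : Finset Q)
    (hdet : Deterministic μ)
    (hlive : ∀ q : Q, Live μ F q)
    (sol : Q → Ctx Sig ar Q)
    (hsol : ∀ q : Q, SignOfLife μ F (sol q) q)
    (hsolF : ∀ q ∈ F, sol q = Ctx.hole)
    (hsolcl : ∀ q q' : Q, WeakEquiv μ F q q' → sol q = sol q')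
    (lam : Q → S) (hlam : ∀ q : Q, lam q = tweight μ ((sol q).subst (.state q))) :
    Equivalence (MNEquiv μ F) ∧
    IsCongruence (ar := fun p : Sig × S => ar p.1) (synMu (push lam μ)) (MNEquiv μ F) ∧
    Respects (MNEquiv μ F) F := by
  have μ_ne_zero : ∀ s qs q, push lam μ s qs q ≠ 0 → μ s qs q ≠ 0 := fun s qs q h =>
    right_ne_zero_of_mul (left_ne_zero_of_mul h)
  have transfer : ∀ (p : Sig × S) (qs qs' : Fin (ar p.1) → Q),
      (∀ i, MNEquiv μ F (qs i) (qs' i)) → ∀ q, synMu (push lam μ) p qs q ≠ 0 →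
      ∃ q', synMu (push lam μ) p qs' q' ≠ 0 ∧ μ p.1 qs' q' ≠ 0 ∧ MNEquiv μ F q q' := by
    intro p qs qs' hqs q hq
    obtain ⟨hpush, hp⟩ := (synMu_ne_zero_iff _ _ _ _).mp hq
    have hμ := μ_ne_zero p.1 qs q (hpush ▸ hp)
    obtain ⟨q', hq', hequiv, heq⟩ := exists_mnEquiv_push_eq hdet hsol hsolcl hlam hqs hμ
    exact ⟨q', (synMu_ne_zero_iff _ _ _ _).mpr ⟨heq.trans hpush, hp⟩, hq', hequiv⟩
  refine ⟨mnEquiv_equivalence μ F, fun p qs qs' hqs => ⟨⟨?_, ?_⟩, ?_⟩, mnEquiv_respects hdet⟩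
  · rintro ⟨q, hq⟩
    obtain ⟨q', hq', -⟩ := transfer p qs qs' hqs q hq
    exact ⟨q', hq'⟩
  · rintro ⟨q, hq⟩
    obtain ⟨q', hq', -⟩ :=
      transfer p qs' qs (fun i => (mnEquiv_equivalence μ F).symm (hqs i)) q hq
    exact ⟨q', hq'⟩
  · intro q q' hq hq'
    obtain ⟨q'', -, hq'', hequiv⟩ := transfer p qs qs' hqs q hq
    obtain ⟨hpush, hp⟩ := (synMu_ne_zero_iff _ _ _ _).mp hq'
    rwa [hdet p.1 qs' q' q'' (μ_ne_zero p.1 qs' q' (hpush ▸ hp)) hq'']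

end WTA
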